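/- If every finite (q₁,q₂)-uniform hypergraph containing none of the following is asymmetrically 2-colorable: a short edge with a non-simple cover, a spoiled simple path, a simple path with a saw, or a simple path with a spoiled extension. (Deterministic lemma: every (q₁,q₂)-uniform hypergraph that is not asymmetrically 2-colorable contains one of these four 2-blocking configurations.) -/

import Mathlib

variable {V : Type*}

/-- A `(q₁,q₂)`-uniform hypergraph is asymmetrically 2-colorable if its vertices can be
colored red (`true`) / blue (`false`) with no long (size `q₁`) edge entirely red and no
short (size `q₂`) edge entirely blue. -/
def AsymColorable (q₁ q₂ : ℕ) (H : Finset (Finset V)) : Prop :=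
  ∃ c : V → Bool, ∀ E ∈ H,
    (E.card = q₁ → ∃ v ∈ E, c v = false) ∧ (E.card = q₂ → ∃ v ∈ E, c v = true)

/-- `C 0, …, C (q₂-1)` is a cover of the short edge `E` by long edges: each `C j` is a
long edge of `H` meeting `E` in exactly one vertex, and every vertex of `E` is so
covered. -/
def IsCover [DecidableEq V] (q₁ q₂ : ℕ) (H : Finset (Finset V)) (E : Finset V)
    (C : ℕ → Finset V) : Prop :=
  (∀ j < q₂, C j ∈ H ∧ (C j).card = q₁ ∧ ∃ v ∈ E, E ∩ C j = {v}) ∧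
  (∀ v ∈ E, ∃ j < q₂, E ∩ C j = {v})

/-- A cover is simple if its edges are pairwise disjoint (outside `E` they never meet,
and they meet `E` in distinct single vertices). -/
def IsSimpleCover [DecidableEq V] (q₂ : ℕ) (C : ℕ → Finset V) : Prop :=
  ∀ j < q₂, ∀ j' < q₂, j ≠ j' → C j ∩ C j' = ∅

/-- A simple path of length `ℓ ≥ 1`: short edges `S 0, …, S (ℓ-1)`, each simply covered
by long edges `L i 0, …, L i (q₂-1)`, consecutive blocks sharing a long edge
(`L (i+1) 0 = L i (q₂-1)`), and no two edges of the same cardinality intersecting. -/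
def IsSimplePath [DecidableEq V] (q₁ q₂ ℓ : ℕ) (H : Finset (Finset V))
    (S : ℕ → Finset V) (L : ℕ → ℕ → Finset V) : Prop :=
  (∀ i < ℓ, S i ∈ H ∧ (S i).card = q₂) ∧
  (∀ i < ℓ, IsCover q₁ q₂ H (S i) (L i) ∧ IsSimpleCover q₂ (L i)) ∧
  (∀ i, i + 1 < ℓ → L (i + 1) 0 = L i (q₂ - 1)) ∧
  (∀ i < ℓ, ∀ j < ℓ, i ≠ j → S i ∩ S j = ∅) ∧
  (∀ i < ℓ, ∀ j < q₂, ∀ i' < ℓ, ∀ j' < q₂, L i j ≠ L i' j' → L i j ∩ L i' j' = ∅)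

/-- The vertex set of a simple path. -/
def pathVerts [DecidableEq V] (q₂ ℓ : ℕ) (S : ℕ → Finset V) (L : ℕ → ℕ → Finset V) :
    Finset V :=
  ((Finset.range ℓ).biUnion S) ∪
    ((Finset.range ℓ).biUnion fun i => (Finset.range q₂).biUnion fun j => L i j)

/-- The simple path has a saw: for every `v ∈ L 0 0 \ S 0` there is a short edge `T`
with `T ∩ L 0 0 = {v}` and `|T ∩ V(P)| = 2`. -/
def HasSaw [DecidableEq V] (q₁ q₂ ℓ : ℕ) (H : Finset (Finset V))
    (S : ℕ → Finset V) (L : ℕ → ℕ → Finset V) : Prop :=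
  ∀ v ∈ L 0 0 \ S 0, ∃ T ∈ H, T.card = q₂ ∧ T ∩ L 0 0 = {v} ∧
    (T ∩ pathVerts q₂ ℓ S L).card = 2

/-- The simple path is spoiled: there is an edge `E` of `H`, not an edge of the path,
with `|E ∩ V(P)| ≥ 3` and `E ∩ L (ℓ-1) (q₂-1) = {v}` for some `v ∉ S (ℓ-1)`. -/
def IsSpoiled [DecidableEq V] (q₁ q₂ ℓ : ℕ) (H : Finset (Finset V))
    (S : ℕ → Finset V) (L : ℕ → ℕ → Finset V) : Prop :=
  ∃ E ∈ H, (∀ i < ℓ, E ≠ S i) ∧ (∀ i < ℓ, ∀ j < q₂, E ≠ L i j) ∧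
    3 ≤ (E ∩ pathVerts q₂ ℓ S L).card ∧
    ∃ v, v ∉ S (ℓ - 1) ∧ E ∩ L (ℓ - 1) (q₂ - 1) = {v}

/-- The simple path has a spoiled extension: a short edge `T` meeting `V(P)` only in one
vertex of `L (ℓ-1) (q₂-1) \ S (ℓ-1)`, with a simple cover whose first long edge is
`L (ℓ-1) (q₂-1)` and some other covering long edge meets `V(P)`. -/
def HasSpoiledExtension [DecidableEq V] (q₁ q₂ ℓ : ℕ) (H : Finset (Finset V))
    (S : ℕ → Finset V) (L : ℕ → ℕ → Finset V) : Prop :=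
  ∃ T ∈ H, T.card = q₂ ∧
    (∃ v ∈ L (ℓ - 1) (q₂ - 1), v ∉ S (ℓ - 1) ∧ T ∩ pathVerts q₂ ℓ S L = {v}) ∧
    ∃ M : ℕ → Finset V, M 0 = L (ℓ - 1) (q₂ - 1) ∧ IsCover q₁ q₂ H T M ∧
      IsSimpleCover q₂ M ∧ ∃ j, 1 ≤ j ∧ j < q₂ ∧ (M j ∩ pathVerts q₂ ℓ S L).Nonempty

/-- In a minimal non-colorable family every edge is covered at each of its vertices. -/
theorem exists_critical [DecidableEq V] (q₁ q₂ : ℕ) (hq₂ : 3 ≤ q₂)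
    (h12 : q₂ < q₁) (H : Finset (Finset V))
    (huniform : ∀ E ∈ H, E.card = q₁ ∨ E.card = q₂) (hH : ¬ AsymColorable q₁ q₂ H) :
    ∃ G ⊆ H, (∃ E ∈ G, E.card = q₂) ∧
      (∀ E ∈ G, E.card = q₂ → ∀ v ∈ E, ∃ F ∈ G, F.card = q₁ ∧ E ∩ F = {v}) ∧
      (∀ E ∈ G, E.card = q₁ → ∀ v ∈ E, ∃ F ∈ G, F.card = q₂ ∧ E ∩ F = {v}) := by
  obtain ⟨G, hGH, hG⟩ := exists_minimal_le_of_wellFoundedLT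
    (fun G : Finset (Finset V) => ¬ AsymColorable q₁ q₂ G) H hH
  have hGn : ¬ AsymColorable q₁ q₂ G := hG.prop
  have hmin : ∀ E ∈ G, AsymColorable q₁ q₂ (G.erase E) := by
    intro E hE
    by_contra hc
    have := hG.le_of_le hc (Finset.erase_subset _ _)
    exact Finset.notMem_erase E G (this hE)
  refine ⟨G, hGH, ?_, ?_, ?_⟩
  · by_contra hno
    push Not at hno
    apply hGn
    refine ⟨fun _ => false, fun E hE => ⟨fun hc => ?_, fun hc => absurd hc (hno E hE)⟩⟩
    have : E.Nonempty := by rw [← Finset.card_pos]; omega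
    obtain ⟨v, hv⟩ := this
    exact ⟨v, hv, rfl⟩
  · intro E hE hEc v hv
    obtain ⟨c, hc⟩ := hmin E hE
    by_contra hno
    push Not at hno
    have hblue : ∀ u ∈ E, c u = false := by
      by_contra hx
      push Not at hx
      obtain ⟨u, hu, hcu⟩ := hx
      apply hGn
      refine ⟨c, fun F hF => ?_⟩
      by_cases hFE : F = E
      · subst hFE
        exact ⟨fun h => by omega, fun _ => ⟨u, hu, by simpa using hcu⟩⟩
      · exact hc F (Finset.mem_erase.2 ⟨hFE, hF⟩)
    apply hGn
    refine ⟨Function.update c v true, fun F hF => ?_⟩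
    by_cases hFE : F = E
    · subst hFE
      exact ⟨fun h => by omega, fun _ => ⟨v, hv, by simp⟩⟩
    · obtain ⟨h1, h2⟩ := hc F (Finset.mem_erase.2 ⟨hFE, hF⟩)
      constructor
      · intro hFc
        by_contra hx
        push Not at hx
        have hred : ∀ u ∈ F, u ≠ v → c u = true := by
          intro u hu huv
          have := hx u hu
          rw [Function.update_of_ne huv] at this
          simpa using this
        apply hno F hF hFc
        obtain ⟨u, hu, hcu⟩ := h1 hFc
        have huv : u = v := by
          by_contra hne
          simp [hred u hu hne] at hcu
        subst huv
        ext w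
        simp only [Finset.mem_inter, Finset.mem_singleton]
        constructor
        · rintro ⟨hw1, hw2⟩
          by_contra hne
          have := hred w hw2 hne
          simp [hblue w hw1] at this
        · rintro rfl
          exact ⟨hv, hu⟩
      · intro hFc
        obtain ⟨u, hu, hcu⟩ := h2 hFc
        refine ⟨u, hu, ?_⟩
        by_cases huv : u = v
        · simp [huv]
        · rw [Function.update_of_ne huv, hcu]
  · intro E hE hEc v hv
    obtain ⟨c, hc⟩ := hmin E hE
    by_contra hno
    push Not at hno
    have hblue : ∀ u ∈ E, c u = true := by
      by_contra hx
      push Not at hx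
      obtain ⟨u, hu, hcu⟩ := hx
      apply hGn
      refine ⟨c, fun F hF => ?_⟩
      by_cases hFE : F = E
      · subst hFE
        exact ⟨fun _ => ⟨u, hu, by simpa using hcu⟩, fun h => by omega⟩
      · exact hc F (Finset.mem_erase.2 ⟨hFE, hF⟩)
    apply hGn
    refine ⟨Function.update c v false, fun F hF => ?_⟩
    by_cases hFE : F = E
    · subst hFE
      exact ⟨fun _ => ⟨v, hv, by simp⟩, fun h => by omega⟩
    · obtain ⟨h1, h2⟩ := hc F (Finset.mem_erase.2 ⟨hFE, hF⟩)
      constructor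
      · intro hFc
        obtain ⟨u, hu, hcu⟩ := h1 hFc
        refine ⟨u, hu, ?_⟩
        by_cases huv : u = v
        · simp [huv]
        · rw [Function.update_of_ne huv, hcu]
      · intro hFc
        by_contra hx
        push Not at hx
        have hred : ∀ u ∈ F, u ≠ v → c u = false := by
          intro u hu huv
          have := hx u hu
          rw [Function.update_of_ne huv] at this
          simpa using this
        apply hno F hF hFc
        obtain ⟨u, hu, hcu⟩ := h2 hFc
        have huv : u = v := by
          by_contra hne
          simp [hred u hu hne] at hcu
        subst huv
        ext w
        simp only [Finset.mem_inter, Finset.mem_singleton]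
        constructor
        · rintro ⟨hw1, hw2⟩
          by_contra hne
          have := hred w hw2 hne
          simp [hblue w hw1] at this
        · rintro rfl
          exact ⟨hv, hu⟩

/-- A cover with prescribed first edge. -/
theorem exists_cover [DecidableEq V] (q₁ q₂ : ℕ) (hq₂ : 3 ≤ q₂)
    (H G : Finset (Finset V)) (hGH : G ⊆ H)
    (hs : ∀ E ∈ G, E.card = q₂ → ∀ v ∈ E, ∃ F ∈ G, F.card = q₁ ∧ E ∩ F = {v})
    (E : Finset V) (hE : E ∈ G) (hEc : E.card = q₂) (v : V) (hv : v ∈ E)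
    (F : Finset V) (hF : F ∈ G) (hFc : F.card = q₁) (hEF : E ∩ F = {v}) :
    ∃ C : ℕ → Finset V, C 0 = F ∧ IsCover q₁ q₂ H E C ∧ ∀ j < q₂, C j ∈ G := by
  choose! f hfG hfc hfE using hs E hE hEc
  let e₀ := (E.equivFinOfCardEq hEc).symm
  let z : Fin q₂ := ⟨0, by omega⟩
  let e : Fin q₂ ≃ E := (Equiv.swap z (e₀.symm ⟨v, hv⟩)).trans e₀
  have he0 : e z = ⟨v, hv⟩ := by simp [e]
  let g : V → Finset V := fun u => if u = v then F else f u
  have hg : ∀ u ∈ E, g u ∈ G ∧ (g u).card = q₁ ∧ E ∩ g u = {u} := by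
    intro u hu
    by_cases huv : u = v
    · subst huv; simp [g, hF, hFc, hEF]
    · simp only [g, huv, if_false]
      exact ⟨hfG u hu, hfc u hu, hfE u hu⟩
  let C : ℕ → Finset V := fun j => if h : j < q₂ then g (e ⟨j, h⟩) else ∅
  have hC : ∀ j (h : j < q₂), C j = g (e ⟨j, h⟩) := fun j h => by simp [C, h]
  refine ⟨C, ?_, ⟨?_, ?_⟩, ?_⟩
  · rw [hC 0 (by omega)]
    change g (e z) = F
    rw [he0]; simp [g]
  · intro j hj
    rw [hC j hj]
    obtain ⟨h1, h2, h3⟩ := hg (e ⟨j, hj⟩) (e ⟨j, hj⟩).2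
    exact ⟨hGH h1, h2, _, (e ⟨j, hj⟩).2, h3⟩
  · intro u hu
    refine ⟨(e.symm ⟨u, hu⟩).1, (e.symm ⟨u, hu⟩).2, ?_⟩
    rw [hC _ (e.symm ⟨u, hu⟩).2]
    simp [(hg u hu).2.2]
  · intro j hj
    rw [hC j hj]
    exact (hg _ (e ⟨j, hj⟩).2).1

theorem mem_pathVerts [DecidableEq V] {q₂ ℓ : ℕ} {S : ℕ → Finset V}
    {L : ℕ → ℕ → Finset V} {v : V} : v ∈ pathVerts q₂ ℓ S L ↔
      (∃ i < ℓ, v ∈ S i) ∨ ∃ i < ℓ, ∃ j < q₂, v ∈ L i j := by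
  simp [pathVerts]

theorem pathVerts_reverse [DecidableEq V] (q₂ ℓ : ℕ) (S : ℕ → Finset V)
    (L : ℕ → ℕ → Finset V) :
    pathVerts q₂ ℓ (fun i => S (ℓ - 1 - i)) (fun i j => L (ℓ - 1 - i) (q₂ - 1 - j)) =
      pathVerts q₂ ℓ S L := by
  ext v
  rw [mem_pathVerts, mem_pathVerts]
  constructor
  · rintro (⟨i, hi, h⟩ | ⟨i, hi, j, hj, h⟩)
    · exact Or.inl ⟨ℓ - 1 - i, by omega, h⟩
    · exact Or.inr ⟨ℓ - 1 - i, by omega, q₂ - 1 - j, by omega, h⟩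
  · rintro (⟨i, hi, h⟩ | ⟨i, hi, j, hj, h⟩)
    · refine Or.inl ⟨ℓ - 1 - i, by omega, ?_⟩
      rwa [show ℓ - 1 - (ℓ - 1 - i) = i by omega]
    · refine Or.inr ⟨ℓ - 1 - i, by omega, q₂ - 1 - j, by omega, ?_⟩
      rwa [show ℓ - 1 - (ℓ - 1 - i) = i by omega, show q₂ - 1 - (q₂ - 1 - j) = j by omega]

theorem IsSimplePath.reverse [DecidableEq V] {q₁ q₂ ℓ : ℕ} {H : Finset (Finset V)}
    {S : ℕ → Finset V} {L : ℕ → ℕ → Finset V} (h : IsSimplePath q₁ q₂ ℓ H S L) :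
    IsSimplePath q₁ q₂ ℓ H (fun i => S (ℓ - 1 - i))
      (fun i j => L (ℓ - 1 - i) (q₂ - 1 - j)) := by
  obtain ⟨h1, h2, h3, h4, h5⟩ := h
  refine ⟨fun i hi => h1 _ (by omega), fun i hi => ?_, fun i hi => ?_, fun i hi j hj hij => ?_,
    fun i hi j hj i' hi' j' hj' hne => ?_⟩
  · obtain ⟨⟨hc1, hc2⟩, hs⟩ := h2 (ℓ - 1 - i) (by omega)
    refine ⟨⟨fun j hj => hc1 _ (by omega), fun v hv => ?_⟩, fun j hj j' hj' hne => ?_⟩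
    · obtain ⟨j, hj, hjv⟩ := hc2 v hv
      refine ⟨q₂ - 1 - j, by omega, ?_⟩
      change S (ℓ - 1 - i) ∩ L (ℓ - 1 - i) (q₂ - 1 - (q₂ - 1 - j)) = {v}
      rwa [show q₂ - 1 - (q₂ - 1 - j) = j by omega]
    · exact hs _ (by omega) _ (by omega) (by omega)
  · have := h3 (ℓ - 1 - (i + 1)) (by omega)
    rw [show ℓ - 1 - (i + 1) + 1 = ℓ - 1 - i by omega] at this
    simp only [Nat.sub_self, Nat.sub_zero]
    exact this.symm
  · exact h4 _ (by omega) _ (by omega) (by omega)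
  · exact h5 _ (by omega) _ (by omega) _ (by omega) _ (by omega) hne

/-- The extended path. -/
theorem IsSimplePath.extend [DecidableEq V] {q₁ q₂ ℓ : ℕ} (hq₂ : 3 ≤ q₂) (hℓ : 1 ≤ ℓ)
    {H : Finset (Finset V)}
    {S : ℕ → Finset V} {L : ℕ → ℕ → Finset V} (h : IsSimplePath q₁ q₂ ℓ H S L)
    {T : Finset V} {M : ℕ → Finset V} (hT : T ∈ H) (hTc : T.card = q₂)
    (hM : IsCover q₁ q₂ H T M) (hMs : IsSimpleCover q₂ M)
    (hM0 : M 0 = L (ℓ - 1) (q₂ - 1)) (hST : ∀ i < ℓ, S i ∩ T = ∅)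
    (hdis : ∀ j, 1 ≤ j → j < q₂ → M j ∩ pathVerts q₂ ℓ S L = ∅) :
    IsSimplePath q₁ q₂ (ℓ + 1) H (Function.update S ℓ T) (Function.update L ℓ M) := by
  obtain ⟨h1, h2, h3, h4, h5⟩ := h
  have uS : ∀ i < ℓ, Function.update S ℓ T i = S i := fun i hi =>
    Function.update_of_ne (by omega) _ _
  have uL : ∀ i < ℓ, Function.update L ℓ M i = L i := fun i hi =>
    Function.update_of_ne (by omega) _ _
  have hML : ∀ j < q₂, ∀ i < ℓ, ∀ j' < q₂, M j ≠ L i j' → M j ∩ L i j' = ∅ := by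
    intro j hj i hi j' hj' hne
    rcases Nat.eq_zero_or_pos j with rfl | hpos
    · rw [hM0] at hne ⊢
      exact h5 _ (by omega) _ (by omega) _ hi _ hj' hne
    · rw [Finset.eq_empty_iff_forall_notMem]
      intro w hw
      have hw' := Finset.mem_inter.1 hw
      have : w ∈ M j ∩ pathVerts q₂ ℓ S L :=
        Finset.mem_inter.2 ⟨hw'.1, mem_pathVerts.2 (Or.inr ⟨i, hi, j', hj', hw'.2⟩)⟩
      rw [hdis j hpos hj] at this
      simp at this
  refine ⟨fun i hi => ?_, fun i hi => ?_, fun i hi => ?_, fun i hi j hj hij => ?_,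
    fun i hi j hj i' hi' j' hj' hne => ?_⟩
  · rcases Nat.lt_succ_iff_lt_or_eq.1 hi with h | rfl
    · rw [uS i h]; exact h1 i h
    · simp [hT, hTc]
  · rcases Nat.lt_succ_iff_lt_or_eq.1 hi with h | rfl
    · rw [uS i h, uL i h]; exact h2 i h
    · simp [hM, hMs]
  · rcases Nat.lt_succ_iff_lt_or_eq.1 hi with h | h
    · rw [uL _ h, uL i (by omega)]; exact h3 i h
    · rw [uL i (by omega), h, Function.update_self, hM0]
      congr 1
      rw [← h]; simp
  · rcases Nat.lt_succ_iff_lt_or_eq.1 hi with h | rfl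
    · rcases Nat.lt_succ_iff_lt_or_eq.1 hj with h' | rfl
      · rw [uS i h, uS j h']; exact h4 i h j h' hij
      · rw [uS i h, Function.update_self]; exact hST i h
    · rcases Nat.lt_succ_iff_lt_or_eq.1 hj with h' | h'
      · rw [uS j h', Function.update_self, Finset.inter_comm]; exact hST j h'
      · omega
  · rcases Nat.lt_succ_iff_lt_or_eq.1 hi with h | rfl
    · rcases Nat.lt_succ_iff_lt_or_eq.1 hi' with h' | rfl
      · rw [uL i h, uL i' h'] at *; exact h5 i h j hj i' h' j' hj' hne
      · rw [uL i h, Function.update_self] at *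
        rw [Finset.inter_comm]
        exact hML _ hj' _ h _ hj hne.symm
    · rcases Nat.lt_succ_iff_lt_or_eq.1 hi' with h' | rfl
      · rw [uL i' h', Function.update_self] at *
        exact hML _ hj _ h' _ hj' hne
      · rw [Function.update_self] at *
        exact hMs _ hj _ hj' (fun h => hne (by rw [h]))

/-- Deterministic lemma: every finite `(q₁,q₂)`-uniform hypergraph (`q₁ > q₂ ≥ 3`)
containing no short edge with a non-simple cover, no spoiled simple path, no simple path
with a saw, and no simple path with a spoiled extension, is asymmetrically 2-colorable. -/
theorem asym_deterministic_lemma [DecidableEq V] (q₁ q₂ : ℕ) (hq₂ : 3 ≤ q₂)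
    (h12 : q₂ < q₁) (H : Finset (Finset V))
    (huniform : ∀ E ∈ H, E.card = q₁ ∨ E.card = q₂)
    (hNoNonsimpleCover : ¬ ∃ E ∈ H, E.card = q₂ ∧ ∃ C : ℕ → Finset V,
      IsCover q₁ q₂ H E C ∧ ¬ IsSimpleCover q₂ C)
    (hNoSpoiled : ¬ ∃ (ℓ : ℕ) (S : ℕ → Finset V) (L : ℕ → ℕ → Finset V),
      1 ≤ ℓ ∧ IsSimplePath q₁ q₂ ℓ H S L ∧ IsSpoiled q₁ q₂ ℓ H S L)
    (hNoSaw : ¬ ∃ (ℓ : ℕ) (S : ℕ → Finset V) (L : ℕ → ℕ → Finset V),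
      1 ≤ ℓ ∧ IsSimplePath q₁ q₂ ℓ H S L ∧ HasSaw q₁ q₂ ℓ H S L)
    (hNoSpoiledExt : ¬ ∃ (ℓ : ℕ) (S : ℕ → Finset V) (L : ℕ → ℕ → Finset V),
      1 ≤ ℓ ∧ IsSimplePath q₁ q₂ ℓ H S L ∧ HasSpoiledExtension q₁ q₂ ℓ H S L) :
    AsymColorable q₁ q₂ H := by
  by_contra hH
  obtain ⟨G, hGH, ⟨E, hE, hEc⟩, hs, hl⟩ := exists_critical q₁ q₂ hq₂ h12 H huniform hH
  have hsimple : ∀ T ∈ H, T.card = q₂ → ∀ C : ℕ → Finset V, IsCover q₁ q₂ H T C →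
      IsSimpleCover q₂ C := by
    intro T hT hTc C hC
    by_contra hns
    exact hNoNonsimpleCover ⟨T, hT, hTc, C, hC, hns⟩
  have key : ∀ n : ℕ, ∃ (S : ℕ → Finset V) (L : ℕ → ℕ → Finset V),
      IsSimplePath q₁ q₂ (n + 1) H S L ∧ L n (q₂ - 1) ∈ G ∧
      ∀ i < n, S i ∩ L n (q₂ - 1) = ∅ := by
    intro n
    induction n with
    | zero =>
      have : E.Nonempty := by rw [← Finset.card_pos]; omega
      obtain ⟨v, hv⟩ := this
      obtain ⟨F, hF, hFc, hEF⟩ := hs E hE hEc v hv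
      obtain ⟨C, -, hC, hCG⟩ := exists_cover q₁ q₂ hq₂ H G hGH hs E hE hEc v hv F hF hFc hEF
      have hCs := hsimple E (hGH hE) hEc C hC
      refine ⟨fun _ => E, fun _ => C, ⟨fun i hi => ⟨hGH hE, hEc⟩, fun i hi => ⟨hC, hCs⟩,
        fun i hi => by omega, fun i hi j hj hij => by omega,
        fun i hi j hj i' hi' j' hj' hne => hCs j hj j' hj' (fun h => hne (by rw [h]))⟩,
        hCG _ (by omega), fun i hi => by omega⟩
    | succ n ih =>
      obtain ⟨S, L, hP, hKG, hinv⟩ := ih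
      by_contra hno
      have hKc : (L n (q₂ - 1)).card = q₁ :=
        ((hP.2.1 n (by omega)).1.1 (q₂ - 1) (by omega)).2.1
      apply hNoSaw
      refine ⟨n + 1, _, _, by omega, hP.reverse, ?_⟩
      intro w hw
      rw [pathVerts_reverse]
      simp only [Nat.add_sub_cancel, Nat.sub_zero, Finset.mem_sdiff] at hw ⊢
      obtain ⟨hwK, hwS⟩ := hw
      obtain ⟨T, hT, hTc, hKT⟩ := hl _ hKG hKc w hwK
      have hTK : T ∩ L n (q₂ - 1) = {w} := by rw [Finset.inter_comm]; exact hKT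
      have hwT : w ∈ T := by
        have : w ∈ T ∩ L n (q₂ - 1) := by rw [hTK]; simp
        exact (Finset.mem_inter.1 this).1
      have hwSi : ∀ i < n + 1, w ∉ S i := by
        intro i hi hwi
        rcases Nat.lt_succ_iff_lt_or_eq.1 hi with h | rfl
        · have : w ∈ S i ∩ L n (q₂ - 1) := Finset.mem_inter.2 ⟨hwi, hwK⟩
          rw [hinv i h] at this
          simp at this
        · exact hwS hwi
      have hwP : w ∈ pathVerts q₂ (n + 1) S L :=
        mem_pathVerts.2 (Or.inr ⟨n, by omega, q₂ - 1, by omega, hwK⟩)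
      have hwTP : w ∈ T ∩ pathVerts q₂ (n + 1) S L := Finset.mem_inter.2 ⟨hwT, hwP⟩
      refine ⟨T, hGH hT, hTc, hTK, ?_⟩
      have hle : (T ∩ pathVerts q₂ (n + 1) S L).card < 3 := by
        by_contra hge
        apply hNoSpoiled
        refine ⟨n + 1, S, L, by omega, hP, T, hGH hT, fun i hi h => ?_, fun i hi j hj h => ?_,
          by omega, w, hwS, hTK⟩
        · exact hwSi i hi (h ▸ hwT)
        · have := ((hP.2.1 i hi).1.1 j hj).2.1
          rw [← h] at this
          omega
      have hpos : 0 < (T ∩ pathVerts q₂ (n + 1) S L).card := Finset.card_pos.2 ⟨w, hwTP⟩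
      have hne1 : (T ∩ pathVerts q₂ (n + 1) S L).card ≠ 1 := by
        intro h1
        have hTP : T ∩ pathVerts q₂ (n + 1) S L = {w} := by
          obtain ⟨x, hx⟩ := Finset.card_eq_one.1 h1
          rw [hx] at hwTP ⊢
          rw [Finset.mem_singleton.1 hwTP]
        obtain ⟨M, hM0, hM, hMG⟩ :=
          exists_cover q₁ q₂ hq₂ H G hGH hs T hT hTc w hwT _ hKG hKc hTK
        have hMs := hsimple T (hGH hT) hTc M hM
        have hdis : ∀ j, 1 ≤ j → j < q₂ → M j ∩ pathVerts q₂ (n + 1) S L = ∅ := by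
          intro j hj1 hj
          by_contra hne
          exact hNoSpoiledExt ⟨n + 1, S, L, by omega, hP, T, hGH hT, hTc,
            ⟨w, hwK, hwS, hTP⟩, M, hM0, hM, hMs, j, hj1, hj, Finset.nonempty_iff_ne_empty.2 hne⟩
        have hST : ∀ i < n + 1, S i ∩ T = ∅ := by
          intro i hi
          rw [Finset.eq_empty_iff_forall_notMem]
          intro x hx
          obtain ⟨hx1, hx2⟩ := Finset.mem_inter.1 hx
          have : x ∈ T ∩ pathVerts q₂ (n + 1) S L :=
            Finset.mem_inter.2 ⟨hx2, mem_pathVerts.2 (Or.inl ⟨i, hi, hx1⟩)⟩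
          rw [hTP, Finset.mem_singleton] at this
          exact hwSi i hi (this ▸ hx1)
        apply hno
        refine ⟨_, _, hP.extend hq₂ (by omega) (hGH hT) hTc hM hMs hM0 hST hdis, ?_, ?_⟩
        · rw [Function.update_self]; exact hMG _ (by omega)
        · intro i hi
          rw [Function.update_self, Function.update_of_ne (by omega),
            Finset.eq_empty_iff_forall_notMem]
          intro x hx
          obtain ⟨hx1, hx2⟩ := Finset.mem_inter.1 hx
          have : x ∈ M (q₂ - 1) ∩ pathVerts q₂ (n + 1) S L :=
            Finset.mem_inter.2 ⟨hx2, mem_pathVerts.2 (Or.inl ⟨i, hi, hx1⟩)⟩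
          rw [hdis _ (by omega) (by omega)] at this
          simp at this
      omega
  obtain ⟨S, L, hP, -, -⟩ := key H.card
  have hcard : (Finset.range (H.card + 1)).card ≤ H.card := by
    refine Finset.card_le_card_of_injOn S (fun i hi => (hP.1 i (by simpa using hi)).1) ?_
    intro i hi j hj hij
    have hi' : i < H.card + 1 := by simpa using hi
    have hj' : j < H.card + 1 := by simpa using hj
    by_contra hne
    have h0 := hP.2.2.2.1 i hi' j hj' hne
    rw [← hij, Finset.inter_self] at h0
    have := (hP.1 i hi').2
    rw [h0, Finset.card_empty] at this
    omega
  simp at hcard
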